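/- (Theorem 1, decreasing part) Let μ > 0, θ > 0, α ∈ ℝ, and let p* > 0 be a solution of the first-order condition (θp* - 1)·exp(α + θp*) = 1. Then the revenue function R(p) = p·d(p) under logit demand satisfies R'(p) < 0 for all p > p*, and R is strictly decreasing on the interval (p*, ∞). -/

import Mathlib

theorem hasDerivAt_logit_revenue (μ θ α p : ℝ) :
    HasDerivAt
      (fun p : ℝ => p * (μ * Real.exp (-(α + θ * p)) / (1 + Real.exp (-(α + θ * p)))))
      (μ * Real.exp (-(α + θ * p)) * (1 + Real.exp (-(α + θ * p)) - θ * p) /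
        (1 + Real.exp (-(α + θ * p))) ^ 2) p := by
  have hne : 1 + Real.exp (-(α + θ * p)) ≠ 0 := by positivity
  have hexp : HasDerivAt (fun p : ℝ => Real.exp (-(α + θ * p)))
      (Real.exp (-(α + θ * p)) * -(θ * 1)) p :=
    (((hasDerivAt_id p).const_mul θ).const_add α).neg.exp
  refine ((hasDerivAt_id p).mul ((hexp.const_mul μ).div (hexp.const_add 1) hne)).congr_deriv ?_
  simp only [id, Pi.div_apply]
  field_simp
  ring

theorem one_add_exp_neg_lt_of_foc {θ α q p : ℝ} (hθ : 0 < θ)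
    (hfoc : (θ * q - 1) * Real.exp (α + θ * q) = 1) (hqp : q < p) :
    1 + Real.exp (-(α + θ * p)) < θ * p := by
  have hlt : θ * q < θ * p := mul_lt_mul_of_pos_left hqp hθ
  have hq : θ * q - 1 = Real.exp (-(α + θ * q)) := by
    rw [Real.exp_neg]
    exact eq_inv_of_mul_eq_one_left hfoc
  have hexp : Real.exp (-(α + θ * p)) < Real.exp (-(α + θ * q)) :=
    Real.exp_lt_exp.mpr (by linarith)
  linarith

/-- Theorem 1, decreasing part: if `p* > 0` solves the first-order
condition `(θp* - 1)·exp(α + θp*) = 1`, then `R'(p) < 0` for all `p > p*`, and the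
revenue `R(p) = p·d(p)` is strictly decreasing on `(p*, ∞)`. -/
theorem logit_revenue_decreasing (μ θ α : ℝ) (hμ : 0 < μ) (hθ : 0 < θ)
    (pstar : ℝ) (hpstar : 0 < pstar)
    (hfoc : (θ * pstar - 1) * Real.exp (α + θ * pstar) = 1) :
    (∀ p : ℝ, pstar < p →
      deriv (fun p : ℝ =>
        p * (μ * Real.exp (-(α + θ * p)) / (1 + Real.exp (-(α + θ * p))))) p < 0) ∧
    StrictAntiOn
      (fun p : ℝ => p * (μ * Real.exp (-(α + θ * p)) / (1 + Real.exp (-(α + θ * p)))))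
      (Set.Ioi pstar) := by
  have hneg : ∀ p : ℝ, pstar < p →
      deriv (fun p : ℝ =>
        p * (μ * Real.exp (-(α + θ * p)) / (1 + Real.exp (-(α + θ * p))))) p < 0 := by
    intro p hp
    rw [(hasDerivAt_logit_revenue μ θ α p).deriv]
    have hlt := one_add_exp_neg_lt_of_foc hθ hfoc hp
    exact div_neg_of_neg_of_pos (mul_neg_of_pos_of_neg (by positivity) (by linarith))
      (by positivity)
  refine ⟨hneg, strictAntiOn_of_deriv_neg (convex_Ioi pstar) ?_ ?_⟩
  · exact fun p _ => (hasDerivAt_logit_revenue μ θ α p).continuousAt.continuousWithinAt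
  · intro p hp
    rw [interior_Ioi] at hp
    exact hneg p hp
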